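/- If ‖x(j)‖ ≤ K for every j ∈ J, then for every β ∈ ℝ^p the covariance matrices satisfy ‖V(β;L) − Ṽ(β;L)‖ ≤ 2 K² · L³ · (L − 1) · exp(4 K ‖β‖) / |J|, where ‖·‖ on matrices denotes the operator (spectral) norm. -/

import Mathlib

open scoped RealInnerProductSpace BigOperators

/-- The operator (spectral) norm of a real `p × p` matrix, i.e. the operator
norm of the associated linear map on Euclidean space. -/
noncomputable def matrixOpNorm {p : ℕ} (M : Matrix (Fin p) (Fin p) ℝ) : ℝ :=
  ‖LinearMap.toContinuousLinearMap (Matrix.toEuclideanLin M)‖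

/-- `X(S) = Σ_{j∈S} x j`. -/
noncomputable def subsetSum {p : ℕ} {J : Type*}
    (x : J → EuclideanSpace ℝ (Fin p)) (S : Finset J) : EuclideanSpace ℝ (Fin p) :=
  ∑ j ∈ S, x j

/-- `W(β;L) = Σ_{S⊆J, |S|=L} exp⟪β, X(S)⟫`. -/
noncomputable def subsetWeight {p : ℕ} {J : Type*} [Fintype J]
    (x : J → EuclideanSpace ℝ (Fin p)) (L : ℕ) (β : EuclideanSpace ℝ (Fin p)) : ℝ :=
  ∑ S ∈ Finset.powersetCard L (Finset.univ : Finset J), Real.exp ⟪β, subsetSum x S⟫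

/-- `E(β;L) = W(β;L)⁻¹ Σ_{S⊆J, |S|=L} exp⟪β, X(S)⟫ • X(S)`. -/
noncomputable def subsetMean {p : ℕ} {J : Type*} [Fintype J]
    (x : J → EuclideanSpace ℝ (Fin p)) (L : ℕ) (β : EuclideanSpace ℝ (Fin p)) :
    EuclideanSpace ℝ (Fin p) :=
  (subsetWeight x L β)⁻¹ •
    ∑ S ∈ Finset.powersetCard L (Finset.univ : Finset J),
      Real.exp ⟪β, subsetSum x S⟫ • subsetSum x S

/-- `V(β;L) = W(β;L)⁻¹ Σ_{S⊆J, |S|=L} w(β,S) (X(S)−E(β;L))(X(S)−E(β;L))ᵀ`. -/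
noncomputable def subsetCov {p : ℕ} {J : Type*} [Fintype J]
    (x : J → EuclideanSpace ℝ (Fin p)) (L : ℕ) (β : EuclideanSpace ℝ (Fin p)) :
    Matrix (Fin p) (Fin p) ℝ :=
  Matrix.of fun i i' =>
    (subsetWeight x L β)⁻¹ *
      ∑ S ∈ Finset.powersetCard L (Finset.univ : Finset J),
        Real.exp ⟪β, subsetSum x S⟫ *
          ((subsetSum x S - subsetMean x L β) i *
            (subsetSum x S - subsetMean x L β) i')

/-- `Ẽ(β;L) = L · (Σ_j exp⟪β,x j⟫ • x j) / (Σ_j exp⟪β,x j⟫)`. -/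
noncomputable def tildeMean {p : ℕ} {J : Type*} [Fintype J]
    (x : J → EuclideanSpace ℝ (Fin p)) (L : ℕ) (β : EuclideanSpace ℝ (Fin p)) :
    EuclideanSpace ℝ (Fin p) :=
  (L : ℝ) • ((∑ j, Real.exp ⟪β, x j⟫)⁻¹ • ∑ j, Real.exp ⟪β, x j⟫ • x j)

/-- `Ṽ(β;L) = L · W̄(β)⁻¹ Σ_j exp⟪β,x j⟫ (x j − L⁻¹Ẽ(β;L))(x j − L⁻¹Ẽ(β;L))ᵀ`. -/
noncomputable def tildeCov {p : ℕ} {J : Type*} [Fintype J]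
    (x : J → EuclideanSpace ℝ (Fin p)) (L : ℕ) (β : EuclideanSpace ℝ (Fin p)) :
    Matrix (Fin p) (Fin p) ℝ :=
  Matrix.of fun i i' =>
    (L : ℝ) * ((∑ j, Real.exp ⟪β, x j⟫)⁻¹ *
      ∑ j, Real.exp ⟪β, x j⟫ *
        ((x j - (L : ℝ)⁻¹ • tildeMean x L β) i *
          (x j - (L : ℝ)⁻¹ • tildeMean x L β) i'))

open Finset in
/-- Conditioning a finite probability distribution on an event of mass `d` changes the variance of
a function bounded by `B` by at most `4 * B ^ 2 * (1 - d)`. -/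
theorem abs_condVariance_sub_variance_le {Ω : Type*} [Fintype Ω] [DecidableEq Ω]
    {P A : Ω → ℝ} {B μ d m : ℝ} {D : Finset Ω}
    (hP : ∀ f, 0 ≤ P f) (hP1 : ∑ f, P f = 1) (hA : ∀ f, |A f| ≤ B)
    (hμ : ∑ f, P f * (A f - μ) = 0) (hd : 0 < d) (hdD : ∑ f ∈ D, P f = d)
    (hm : ∑ f ∈ D, P f * A f = d * m) :
    |d⁻¹ * ∑ f ∈ D, P f * (A f - m) ^ 2 - ∑ f, P f * (A f - μ) ^ 2| ≤ 4 * B ^ 2 * (1 - d) := by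
  have shift : ∀ c, ∑ f ∈ D, P f * (A f - c) ^ 2
      = ∑ f ∈ D, P f * (A f - m) ^ 2 + d * (c - m) ^ 2 := by
    intro c
    have h : ∀ f, P f * (A f - c) ^ 2
        = P f * (A f - m) ^ 2 + (2 * (m - c)) * (P f * A f) + (c ^ 2 - m ^ 2) * P f := by
      intro f; ring
    simp_rw [h, sum_add_distrib, ← mul_sum, hm, hdD]
    ring
  have shift' : ∑ f, P f * (A f - m) ^ 2 = ∑ f, P f * (A f - μ) ^ 2 + (m - μ) ^ 2 := by
    have h : ∀ f, P f * (A f - m) ^ 2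
        = P f * (A f - μ) ^ 2 + (2 * (μ - m)) * (P f * (A f - μ)) + (m - μ) ^ 2 * P f := by
      intro f; ring
    simp_rw [h, sum_add_distrib, ← mul_sum, hμ, hP1]
    ring
  have hd1 : d ≤ 1 := by
    rw [← hdD, ← hP1]
    exact sum_le_univ_sum_of_nonneg hP
  have hmB : |m| ≤ B := by
    have h : |d * m| ≤ d * B := by
      rw [← hm, ← hdD, sum_mul]
      refine (abs_sum_le_sum_abs _ _).trans (sum_le_sum fun f _ => ?_)
      rw [abs_mul, abs_of_nonneg (hP f)]
      exact mul_le_mul_of_nonneg_left (hA f) (hP f)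
    rw [abs_mul, abs_of_pos hd] at h
    exact le_of_mul_le_mul_left h hd
  have hsplit : ∀ c, ∑ f, P f * (A f - c) ^ 2
      = ∑ f ∈ D, P f * (A f - c) ^ 2 + ∑ f ∈ Dᶜ, P f * (A f - c) ^ 2 :=
    fun c => (sum_add_sum_compl D _).symm
  have hdc : ∑ f ∈ Dᶜ, P f = 1 - d := by
    rw [← hP1, ← sum_add_sum_compl D, hdD]; ring
  have hcompl : ∑ f ∈ Dᶜ, P f * (A f - m) ^ 2 ≤ (1 - d) * (4 * B ^ 2) := by
    rw [← hdc, sum_mul]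
    refine sum_le_sum fun f _ => mul_le_mul_of_nonneg_left ?_ (hP f)
    have h1 := abs_le.1 (hA f)
    have h2 := abs_le.1 hmB
    nlinarith
  have hcompl0 : 0 ≤ ∑ f ∈ Dᶜ, P f * (A f - μ) ^ 2 :=
    sum_nonneg fun f _ => mul_nonneg (hP f) (sq_nonneg _)
  have hD0 : 0 ≤ ∑ f ∈ D, P f * (A f - m) ^ 2 :=
    sum_nonneg fun f _ => mul_nonneg (hP f) (sq_nonneg _)
  have hDB : ∑ f ∈ D, P f * (A f - m) ^ 2 ≤ d * B ^ 2 := by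
    have h := shift 0
    have h' : ∑ f ∈ D, P f * (A f - 0) ^ 2 ≤ d * B ^ 2 := by
      rw [← hdD, sum_mul]
      refine sum_le_sum fun f _ => mul_le_mul_of_nonneg_left ?_ (hP f)
      rw [sub_zero, ← sq_abs]
      exact pow_le_pow_left₀ (abs_nonneg _) (hA f) 2
    nlinarith [mul_nonneg hd.le (sq_nonneg (0 - m))]
  obtain ⟨V, hV⟩ : ∃ V, V = d⁻¹ * ∑ f ∈ D, P f * (A f - m) ^ 2 := ⟨_, rfl⟩
  have hdV : ∑ f ∈ D, P f * (A f - m) ^ 2 = d * V := by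
    rw [hV]; field_simp
  rw [← hV]
  rw [hdV] at hD0 hDB
  have hV0 : 0 ≤ V := nonneg_of_mul_nonneg_right hD0 hd
  have hVB : V ≤ B ^ 2 := le_of_mul_le_mul_left hDB hd
  have e1 := hsplit m
  have e2 := hsplit μ
  have e3 := shift μ
  rw [hdV] at e1 e3
  rw [abs_le]
  constructor
  · nlinarith [sq_nonneg (m - μ)]
  · nlinarith [mul_nonneg hd.le (sq_nonneg (μ - m)), mul_nonneg (sub_nonneg.2 hd1) (sq_nonneg B)]

section IndependentTuples

open Finset

variable {J : Type*} [Fintype J]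

theorem sum_fin_succ_fun {L : ℕ} (F : (Fin (L + 1) → J) → ℝ) :
    ∑ f, F f = ∑ j, ∑ f : Fin L → J, F (Fin.cons j f : Fin (L + 1) → J) := by
  rw [← Fintype.sum_prod_type']
  exact (Equiv.sum_comp (Fin.consEquiv fun _ : Fin (L + 1) => J) F).symm

theorem sum_prod_tuple_eq_one {q : J → ℝ} (hq : ∑ j, q j = 1) (L : ℕ) :
    ∑ f : Fin L → J, ∏ i, q (f i) = 1 := by
  induction L with
  | zero => simp
  | succ L ih =>
    rw [sum_fin_succ_fun]
    simp [Fin.prod_univ_succ, ← mul_sum, ih, hq]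

theorem sum_prod_tuple_mul_sum_eq_zero {q c : J → ℝ} (hq : ∑ j, q j = 1)
    (hc : ∑ j, q j * c j = 0) (L : ℕ) :
    ∑ f : Fin L → J, (∏ i, q (f i)) * ∑ i, c (f i) = 0 := by
  induction L with
  | zero => simp
  | succ L ih =>
    rw [sum_fin_succ_fun]
    have h : ∀ (j : J) (f : Fin L → J), q j * (∏ i, q (f i)) * (c j + ∑ i, c (f i))
        = q j * c j * (∏ i, q (f i)) + q j * ((∏ i, q (f i)) * ∑ i, c (f i)) := by
      intros; ring
    simp only [Fin.prod_univ_succ, Fin.sum_univ_succ, Fin.cons_zero, Fin.cons_succ, h,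
      sum_add_distrib, ← mul_sum, ih, sum_prod_tuple_eq_one hq, mul_one, hc, mul_zero, add_zero]

theorem sum_prod_tuple_mul_sum_sq {q c : J → ℝ} (hq : ∑ j, q j = 1)
    (hc : ∑ j, q j * c j = 0) (L : ℕ) :
    ∑ f : Fin L → J, (∏ i, q (f i)) * (∑ i, c (f i)) ^ 2 = L * ∑ j, q j * c j ^ 2 := by
  induction L with
  | zero => simp
  | succ L ih =>
    rw [sum_fin_succ_fun]
    have h : ∀ (j : J) (f : Fin L → J), q j * (∏ i, q (f i)) * (c j + ∑ i, c (f i)) ^ 2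
        = q j * c j ^ 2 * (∏ i, q (f i)) + 2 * (q j * c j) * ((∏ i, q (f i)) * ∑ i, c (f i))
          + q j * ((∏ i, q (f i)) * (∑ i, c (f i)) ^ 2) := by
      intros; ring
    simp only [Fin.prod_univ_succ, Fin.sum_univ_succ, Fin.cons_zero, Fin.cons_succ, h,
      sum_add_distrib, ← mul_sum, ih, sum_prod_tuple_eq_one hq,
      sum_prod_tuple_mul_sum_eq_zero hq hc, mul_one, mul_zero, add_zero,
      ← sum_mul, hq, one_mul]
    push_cast
    ring

open Classical in
/-- The birthday bound: `L` independent draws collide with probability at most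
`L * (L - 1) / 2` times the largest atom. -/
theorem sum_prod_tuple_not_injective_le {q : J → ℝ} (hq0 : ∀ j, 0 ≤ q j) (hq : ∑ j, q j = 1)
    {r : ℝ} (hr : ∀ j, q j ≤ r) (L : ℕ) :
    ∑ f : Fin L → J, (if Function.Injective f then 0 else ∏ i, q (f i))
      ≤ (L : ℝ) * ((L : ℝ) - 1) / 2 * r := by
  induction L with
  | zero => simp [Function.injective_of_subsingleton]
  | succ L ih =>
    have hle : ∀ (j : J) (f : Fin L → J),
        (if Function.Injective (Fin.cons j f : Fin (L + 1) → J) then 0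
          else ∏ i, q ((Fin.cons j f : Fin (L + 1) → J) i))
        ≤ q j * (if Function.Injective f then 0 else ∏ i, q (f i))
          + (∏ i, q (f i)) * ∑ i, if f i = j then q j else 0 := by
      intro j f
      have hp : 0 ≤ ∏ i, q (f i) := prod_nonneg fun i _ => hq0 _
      have hs : ∀ i ∈ univ, 0 ≤ if f i = j then q j else 0 := by
        intro i _; split_ifs <;> simp [hq0]
      have hs' := sum_nonneg hs
      rw [Fin.prod_univ_succ]
      simp only [Fin.cons_injective_iff, Fin.cons_zero, Fin.cons_succ]
      by_cases hf : Function.Injective f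
      · by_cases hj : j ∈ Set.range f
        · obtain ⟨i, rfl⟩ := hj
          have := single_le_sum hs (mem_univ i)
          simp only [if_true] at this
          simp only [Set.mem_range_self, not_true, false_and, if_false, hf, if_true, mul_zero,
            zero_add]
          rw [mul_comm]
          exact mul_le_mul_of_nonneg_left this hp
        · simp only [hj, hf, not_false_eq_true, and_self, if_true, mul_zero, zero_add]
          exact mul_nonneg hp hs'
      · simp only [hf, and_false, if_false]
        linarith [mul_nonneg hp hs']
    rw [sum_fin_succ_fun]
    refine (sum_le_sum fun j _ => sum_le_sum fun f _ => hle j f).trans ?_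
    simp only [sum_add_distrib, ← mul_sum]
    rw [← sum_mul, hq, one_mul, sum_comm]
    have hcoll : ∑ f : Fin L → J, ∑ j, (∏ i, q (f i)) * ∑ i, (if f i = j then q j else 0)
        ≤ L * r := by
      calc _ ≤ ∑ f : Fin L → J, (∏ i, q (f i)) * (L * r) := by
            refine sum_le_sum fun f _ => ?_
            rw [← mul_sum, sum_comm]
            refine mul_le_mul_of_nonneg_left ?_ (prod_nonneg fun i _ => hq0 _)
            simp only [sum_ite_eq, mem_univ, if_true]
            refine (sum_le_sum fun i _ => hr (f i)).trans ?_
            simp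
        _ = L * r := by rw [← sum_mul, sum_prod_tuple_eq_one hq, one_mul]
    push_cast
    linarith

open Classical in
theorem card_injective_tuple_image_eq {L : ℕ} {S : Finset J} (hS : S.card = L) :
    (univ.filter fun f : Fin L → J => Function.Injective f ∧ univ.image f = S).card
      = L.factorial := by
  have e : Fin L ≃ S := (S.equivFinOfCardEq hS).symm
  have hcard : Fintype.card (Fin L ≃ S) = L.factorial := by
    rw [Fintype.card_equiv e, Fintype.card_fin]
  rw [← hcard, ← card_univ]
  symm
  refine card_bij (fun g _ i => (g i : J)) ?_ ?_ ?_
  · intro g _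
    simp only [mem_filter, mem_univ, true_and]
    refine ⟨Subtype.val_injective.comp g.injective, ?_⟩
    ext j
    simp only [mem_image, mem_univ, true_and]
    constructor
    · rintro ⟨i, rfl⟩
      exact (g i).2
    · intro hj
      exact ⟨g.symm ⟨j, hj⟩, by simp⟩
  · intro g _ g' _ h
    ext i
    exact congrFun h i
  · intro f hf
    simp only [mem_filter, mem_univ, true_and] at hf
    obtain ⟨hinj, rfl⟩ := hf
    refine ⟨Equiv.ofBijective (fun i => ⟨f i, mem_image_of_mem f (mem_univ i)⟩) ⟨?_, ?_⟩,
      mem_univ _, rfl⟩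
    · intro i i' h
      exact hinj (congrArg Subtype.val h)
    · rintro ⟨j, hj⟩
      obtain ⟨i, -, rfl⟩ := mem_image.1 hj
      exact ⟨i, rfl⟩

open Classical in
theorem sum_injective_tuple_image {L : ℕ} (g : Finset J → ℝ) :
    ∑ f : Fin L → J with Function.Injective f, g (univ.image f)
      = L.factorial * ∑ S ∈ powersetCard L univ, g S := by
  have hmaps : ∀ f ∈ univ.filter (fun f : Fin L → J => Function.Injective f),
      univ.image f ∈ powersetCard L (univ : Finset J) := by
    intro f hf
    rw [mem_filter] at hf
    simp [mem_powersetCard, card_image_of_injective _ hf.2]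
  rw [← sum_fiberwise_of_maps_to hmaps, mul_sum]
  refine sum_congr rfl fun S hS => ?_
  rw [filter_filter]
  rw [← card_injective_tuple_image_eq (mem_powersetCard.1 hS).2, ← nsmul_eq_mul]
  refine sum_eq_card_nsmul fun f hf => ?_
  rw [(mem_filter.1 hf).2.2]

open Classical in
/-- The sum `∑ j ∈ S, a j` over a random `L`-subset `S`, drawn with probability proportional to
`∏ j ∈ S, w j`, has nearly the variance of the sum of `L` independent draws of `a` with
probabilities proportional to `w`. -/
theorem abs_subsetVariance_sub_le {w a : J → ℝ} {K r : ℝ} {L : ℕ} (hLJ : L ≤ Fintype.card J)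
    (hL : 1 ≤ L) (hw : ∀ j, 0 < w j) (hr : ∀ j, w j ≤ r * ∑ j, w j) (ha : ∀ j, |a j| ≤ K)
    {W m μ : ℝ} (hW : W = ∑ S ∈ powersetCard L (univ : Finset J), ∏ j ∈ S, w j)
    (hm : m = W⁻¹ * ∑ S ∈ powersetCard L (univ : Finset J), (∏ j ∈ S, w j) * ∑ j ∈ S, a j)
    (hμ : μ = (∑ j, w j)⁻¹ * ∑ j, w j * a j) :
    |W⁻¹ * ∑ S ∈ powersetCard L (univ : Finset J), (∏ j ∈ S, w j) * (∑ j ∈ S, a j - m) ^ 2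
        - L * ((∑ j, w j)⁻¹ * ∑ j, w j * (a j - μ) ^ 2)|
      ≤ 2 * K ^ 2 * (L : ℝ) ^ 3 * ((L : ℝ) - 1) * r := by
  have : Nonempty J := Fintype.card_pos_iff.1 (by omega)
  obtain ⟨Z, hZ⟩ : ∃ Z, Z = ∑ j, w j := ⟨_, rfl⟩
  have hZ0 : 0 < Z := hZ ▸ sum_pos (fun j _ => hw j) univ_nonempty
  have hW0 : 0 < W := by
    rw [hW]
    exact sum_pos (fun S _ => prod_pos fun j _ => hw j)
      (powersetCard_nonempty.2 (by simpa using hLJ))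
  rw [← hZ] at hμ ⊢
  simp_rw [← hZ] at hr
  obtain ⟨q, hq⟩ : ∃ q : J → ℝ, q = fun j => Z⁻¹ * w j := ⟨_, rfl⟩
  have hq0 : ∀ j, 0 < q j := fun j => by rw [hq]; exact mul_pos (inv_pos.2 hZ0) (hw j)
  have hq1 : ∑ j, q j = 1 := by
    rw [hq, ← mul_sum, ← hZ, inv_mul_cancel₀ hZ0.ne']
  have hqr : ∀ j, q j ≤ r := fun j => by
    rw [hq]
    simp only
    rw [inv_mul_le_iff₀ hZ0, mul_comm]
    exact hr j
  have hqsum : ∀ h : J → ℝ, ∑ j, q j * h j = Z⁻¹ * ∑ j, w j * h j := by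
    intro h
    rw [hq, mul_sum]
    exact sum_congr rfl fun j _ => by ring
  have hqc : ∑ j, q j * (a j - μ) = 0 := by
    simp_rw [mul_sub, sum_sub_distrib, ← sum_mul, hq1, hqsum, hμ]
    ring
  obtain ⟨D, hD⟩ : ∃ D, D = univ.filter fun f : Fin L → J => Function.Injective f := ⟨_, rfl⟩
  obtain ⟨C, hC⟩ : ∃ C, C = (L.factorial : ℝ) * Z⁻¹ ^ L := ⟨_, rfl⟩
  have hC0 : 0 < C := by rw [hC]; positivity
  have transfer : ∀ h : ℝ → ℝ, ∑ f ∈ D, (∏ i, q (f i)) * h (∑ i, a (f i))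
      = C * ∑ S ∈ powersetCard L (univ : Finset J), (∏ j ∈ S, w j) * h (∑ j ∈ S, a j) := by
    intro h
    rw [hC, mul_assoc, mul_left_comm, hD, ← sum_injective_tuple_image, mul_sum]
    refine sum_congr rfl fun f hf => ?_
    have hf' : Function.Injective f := (mem_filter.1 hf).2
    rw [prod_image hf'.injOn, sum_image hf'.injOn, hq]
    simp only [prod_mul_distrib, prod_const, card_univ, Fintype.card_fin]
    ring
  have hd : ∑ f ∈ D, ∏ i, q (f i) = C * W := by
    have := transfer fun _ => 1
    simpa [← hW] using this
  have hsub : ∀ f : Fin L → J, ∑ i, (a (f i) - μ) = ∑ i, a (f i) - L * μ := by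
    intro f; simp [sum_sub_distrib]
  have hmean := sum_prod_tuple_mul_sum_eq_zero hq1 hqc L
  have hvar := sum_prod_tuple_mul_sum_sq hq1 hqc L
  simp_rw [hsub] at hmean hvar
  have hm' : ∑ f ∈ D, (∏ i, q (f i)) * ∑ i, a (f i) = C * W * m := by
    have := transfer fun t => t
    rw [this, hm]
    field_simp
  have hbound : ∀ f : Fin L → J, |∑ i, a (f i)| ≤ L * K := by
    intro f
    refine (abs_sum_le_sum_abs _ _).trans ((sum_le_sum fun i _ => ha (f i)).trans ?_)
    simp
  have key := abs_condVariance_sub_variance_le (fun f => prod_nonneg fun i _ => (hq0 (f i)).le)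
    (sum_prod_tuple_eq_one hq1 L) hbound hmean (mul_pos hC0 hW0) hd hm'
  rw [hvar, transfer fun t => (t - m) ^ 2, hqsum] at key
  have hscale : ∀ t, (C * W)⁻¹ * (C * t) = W⁻¹ * t := by
    intro t; field_simp
  rw [hscale] at key
  refine key.trans ?_
  have hcoll := sum_prod_tuple_not_injective_le (fun j => (hq0 j).le) hq1 hqr L
  have hcompl : ∑ f : Fin L → J, (if Function.Injective f then 0 else ∏ i, q (f i))
      = 1 - C * W := by
    rw [← hd, ← sum_prod_tuple_eq_one hq1 L, hD, sum_filter, ← sum_sub_distrib]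
    refine sum_congr rfl fun f _ => ?_
    split_ifs <;> simp
  rw [hcompl] at hcoll
  calc 4 * ((L : ℝ) * K) ^ 2 * (1 - C * W)
      ≤ 4 * ((L : ℝ) * K) ^ 2 * ((L : ℝ) * ((L : ℝ) - 1) / 2 * r) :=
        mul_le_mul_of_nonneg_left hcoll (by positivity)
    _ = _ := by ring

end IndependentTuples

section QuadraticForm

open Matrix

variable {p : ℕ}

theorem matrixOpNorm_le_of_isSymm {M : Matrix (Fin p) (Fin p) ℝ} (hM : M.IsSymm) {C : ℝ}
    (hC : 0 ≤ C)
    (h : ∀ u : EuclideanSpace ℝ (Fin p), ‖u‖ = 1 → |u.ofLp ⬝ᵥ M *ᵥ u.ofLp| ≤ C) :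
    matrixOpNorm M ≤ C := by
  have hsymm : (Matrix.toEuclideanLin M).IsSymmetric := by
    rw [Matrix.isSymmetric_toEuclideanLin_iff]
    exact (Matrix.conjTranspose_eq_transpose_of_trivial M).trans hM
  have hinner : ∀ u : EuclideanSpace ℝ (Fin p),
      ⟪Matrix.toEuclideanLin M u, u⟫ = u.ofLp ⬝ᵥ M *ᵥ u.ofLp := by
    intro u
    rw [EuclideanSpace.inner_eq_star_dotProduct]
    simp
  unfold matrixOpNorm
  rw [ContinuousLinearMap.norm_eq_iSup_rayleighQuotient _ hsymm]
  refine ciSup_le fun u => ?_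
  by_cases hu : u = 0
  · subst hu
    simpa [ContinuousLinearMap.rayleighQuotient] using hC
  · have hn : (‖u‖⁻¹ : ℝ) ≠ 0 := inv_ne_zero (norm_ne_zero_iff.2 hu)
    have h1 : ‖(‖u‖⁻¹ : ℝ) • u‖ = 1 := norm_smul_inv_norm (𝕜 := ℝ) hu
    rw [← ContinuousLinearMap.rayleigh_smul _ u hn, ContinuousLinearMap.rayleighQuotient, h1,
      ContinuousLinearMap.reApplyInnerSelf_apply]
    simpa only [LinearMap.coe_toContinuousLinearMap', hinner, RCLike.re_to_real, one_pow, div_one]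
      using h _ h1

theorem dotProduct_sum_outer_mulVec {ι : Type*} (s : Finset ι) (c : ℝ) (w : ι → ℝ)
    (y : ι → EuclideanSpace ℝ (Fin p)) (u : EuclideanSpace ℝ (Fin p)) :
    u.ofLp ⬝ᵥ (Matrix.of fun i i' => c * ∑ k ∈ s, w k * (y k i * y k i')) *ᵥ u.ofLp
      = c * ∑ k ∈ s, w k * ⟪u, y k⟫ ^ 2 := by
  have hM : (Matrix.of fun i i' => c * ∑ k ∈ s, w k * (y k i * y k i'))
      = c • ∑ k ∈ s, w k • Matrix.vecMulVec (y k).ofLp (y k).ofLp := by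
    ext i i'
    simp [Matrix.sum_apply, Matrix.vecMulVec_apply]
  have hi : ∀ k, ⟪u, y k⟫ = u.ofLp ⬝ᵥ (y k).ofLp := by
    intro k
    rw [EuclideanSpace.inner_eq_star_dotProduct, dotProduct_comm]
    simp
  rw [hM]
  simp only [smul_mulVec, sum_mulVec, dotProduct_smul, dotProduct_sum, vecMulVec_mulVec, hi,
    smul_eq_mul]
  congr 1
  refine Finset.sum_congr rfl fun k _ => ?_
  simp [dotProduct_comm (y k).ofLp u.ofLp, sq]

end QuadraticForm

/-- If `‖x j‖ ≤ K` for all `j ∈ J`, then for every `β` the covariance matrices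
satisfy `‖V(β;L) − Ṽ(β;L)‖ ≤ 2K²·L³·(L−1)·exp(4K‖β‖)/|J|` in the operator
(spectral) norm. -/
theorem cov_subset_approx_bound
    {p : ℕ} (K : ℝ) (hK : 0 ≤ K) (L : ℕ) (hL : 1 ≤ L)
    {J : Type*} [Fintype J] (hLJ : L ≤ Fintype.card J)
    (x : J → EuclideanSpace ℝ (Fin p)) (hx : ∀ j, ‖x j‖ ≤ K)
    (β : EuclideanSpace ℝ (Fin p)) :
    matrixOpNorm (subsetCov x L β - tildeCov x L β)
      ≤ 2 * K ^ 2 * (L : ℝ) ^ 3 * ((L : ℝ) - 1) * Real.exp (4 * K * ‖β‖)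
          / (Fintype.card J : ℝ) := by
  classical
  have hn : 0 < Fintype.card J := by omega
  have hn' : (0 : ℝ) < Fintype.card J := by exact_mod_cast hn
  have hL1 : (0 : ℝ) ≤ (L : ℝ) - 1 := by
    rw [sub_nonneg]; exact_mod_cast hL
  have hL0 : (L : ℝ) ≠ 0 := by
    have : L ≠ 0 := by omega
    exact_mod_cast this
  have hb : 0 ≤ K * ‖β‖ := by positivity
  have hβ : ∀ j, |⟪β, x j⟫| ≤ K * ‖β‖ := fun j =>
    (abs_real_inner_le_norm _ _).trans
      (by rw [mul_comm]; exact mul_le_mul_of_nonneg_right (hx j) (norm_nonneg _))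
  have hlow : Fintype.card J * Real.exp (-(K * ‖β‖)) ≤ ∑ j, Real.exp ⟪β, x j⟫ := by
    rw [← nsmul_eq_mul]
    exact Finset.card_nsmul_le_sum _ _ _ fun j _ => Real.exp_le_exp.2 (abs_le.1 (hβ j)).1
  have hr : ∀ j, Real.exp ⟪β, x j⟫
      ≤ Real.exp (4 * K * ‖β‖) / Fintype.card J * ∑ j, Real.exp ⟪β, x j⟫ := by
    intro j
    calc Real.exp ⟪β, x j⟫ ≤ Real.exp (4 * K * ‖β‖ + -(K * ‖β‖)) :=
          Real.exp_le_exp.2 (by linarith [(abs_le.1 (hβ j)).2])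
      _ = Real.exp (4 * K * ‖β‖) / Fintype.card J
            * (Fintype.card J * Real.exp (-(K * ‖β‖))) := by
          rw [Real.exp_add]; field_simp
      _ ≤ _ := mul_le_mul_of_nonneg_left hlow (by positivity)
  have hexp : ∀ S : Finset J, Real.exp ⟪β, subsetSum x S⟫ = ∏ j ∈ S, Real.exp ⟪β, x j⟫ := by
    intro S
    rw [subsetSum, inner_sum, Real.exp_sum]
  refine matrixOpNorm_le_of_isSymm ?_ (by positivity) fun u hu => ?_
  · ext i i'
    simp only [Matrix.transpose_apply, Matrix.sub_apply, subsetCov, tildeCov, Matrix.of_apply,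
      mul_comm]
  have ha : ∀ j, |⟪u, x j⟫| ≤ K := fun j =>
    (abs_real_inner_le_norm _ _).trans (by rw [hu, one_mul]; exact hx j)
  have hW : subsetWeight x L β = ∑ S ∈ Finset.powersetCard L (Finset.univ : Finset J),
      ∏ j ∈ S, Real.exp ⟪β, x j⟫ :=
    Finset.sum_congr rfl fun S _ => hexp S
  have hm : ⟪u, subsetMean x L β⟫ = (subsetWeight x L β)⁻¹ *
      ∑ S ∈ Finset.powersetCard L (Finset.univ : Finset J),
        (∏ j ∈ S, Real.exp ⟪β, x j⟫) * ∑ j ∈ S, ⟪u, x j⟫ := by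
    simp only [subsetMean, inner_smul_right, inner_sum, hexp]
    simp only [subsetSum, inner_sum]
  have hμ : ⟪u, (L : ℝ)⁻¹ • tildeMean x L β⟫
      = (∑ j, Real.exp ⟪β, x j⟫)⁻¹ * ∑ j, Real.exp ⟪β, x j⟫ * ⟪u, x j⟫ := by
    rw [tildeMean, inv_smul_smul₀ hL0]
    simp only [inner_smul_right, inner_sum]
  have key := abs_subsetVariance_sub_le hLJ hL (fun j => Real.exp_pos ⟪β, x j⟫) hr ha hW hm hμ
  have e1 : dotProduct u.ofLp ((subsetCov x L β).mulVec u.ofLp) = _ := dotProduct_sum_outer_mulVec _ _ _ _ u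
  have e2 : dotProduct u.ofLp ((tildeCov x L β).mulVec u.ofLp)
      = L * ((∑ j, Real.exp ⟪β, x j⟫)⁻¹ *
        ∑ j, Real.exp ⟪β, x j⟫ * ⟪u, x j - (L : ℝ)⁻¹ • tildeMean x L β⟫ ^ 2) := by
    simp only [tildeCov, ← mul_assoc (L : ℝ)]
    exact dotProduct_sum_outer_mulVec _ _ _ _ u
  rw [Matrix.sub_mulVec, dotProduct_sub, e1, e2]
  simp only [inner_sub_right, hexp]
  rw [mul_div_assoc]
  simpa only [subsetSum, inner_sum] using key
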